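/- Let n, m ≥ 0 be integers, θ, η ∈ ℝ, and q, t ∈ ℂ with 1 − t²q^j ≠ 0 for every integer j with 0 ≤ j < n+m. Set y = cos θ and z = cos η. Then: Σ_{k=0}^{n} Σ_{j=0}^{m} [n choose k]_q · [m choose j]_q · (t·e^{i(−θ+η)};q)_k · (t·e^{i(θ−η)};q)_j · (t·e^{−i(θ+η)};q)_{k+j} / (t²;q)_{k+j} · e^{i(2k−n)θ} · e^{i(2j−m)η} = Σ_{l=0}^{m} [m choose l]_q · (−t)^l · q^{l(l−1)/2} · h_{m−l}(z|q) · p_{n+l}(y|z,t,q) / (t²;q)_{n+l}. -/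

import Mathlib

open Finset

section Defs

variable {K : Type*} [Field K]

/-- q-Pochhammer symbol `(a; q)_n = ∏_{j=0}^{n-1} (1 - a q^j)`. -/
def qPoch (a q : K) (n : ℕ) : K := ∏ j ∈ Finset.range n, (1 - a * q ^ j)

/-- Gaussian (q-binomial) coefficient `[n choose k]_q`. -/
def qBinom (q : K) : ℕ → ℕ → K
  | _, 0 => 1
  | 0, _ + 1 => 0
  | n + 1, k + 1 => qBinom q n k + q ^ (k + 1) * qBinom q n (k + 1)

/-- Continuous q-Hermite polynomials `h_n(x|q)`:
`h_{-1} = 0`, `h_0 = 1`, `h_{n+1} = 2x h_n - (1 - q^n) h_{n-1}`. -/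
def hQH (q x : K) : ℕ → K
  | 0 => 1
  | 1 => 2 * x
  | n + 2 => 2 * x * hQH q x (n + 1) - (1 - q ^ (n + 1)) * hQH q x n

/-- The polynomials `b_n(x|q) = (-1)^n q^{n(n-1)/2} h_n(x|q^{-1})` (for `q ≠ 0`). -/
def bQH (q x : K) (n : ℕ) : K := (-1) ^ n * q ^ (n * (n - 1) / 2) * hQH q⁻¹ x n

/-- Al-Salam–Chihara polynomials in conjugate-pair parametrization `p_n(x|y,ρ,q)`:
`p_{-1} = 0`, `p_0 = 1`,
`p_{n+1} = 2(x - ρ y q^n) p_n - (1 - q^n)(1 - ρ² q^{n-1}) p_{n-1}`. -/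
def pASC (q x y ρ : K) : ℕ → K
  | 0 => 1
  | 1 => 2 * (x - ρ * y)
  | n + 2 => 2 * (x - ρ * y * q ^ (n + 1)) * pASC q x y ρ (n + 1)
      - (1 - q ^ (n + 1)) * (1 - ρ ^ 2 * q ^ n) * pASC q x y ρ n

open Classical in
/-- The polynomials `g_n(x|y,ρ,q)`: `ρ^n p_n(y|x,ρ⁻¹,q)` for `ρ ≠ 0`, `b_n(x|q)` for `ρ = 0`. -/
noncomputable def gASC (q x y ρ : K) (n : ℕ) : K :=
  if ρ = 0 then bQH q x n else ρ ^ n * pASC q y x ρ⁻¹ n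

/-- `ω(u,v|ρ) = (1-ρ²)² - 4uvρ(1+ρ²) + 4ρ²(u²+v²)`. -/
def omegaW (u v ρ : K) : K :=
  (1 - ρ ^ 2) ^ 2 - 4 * u * v * ρ * (1 + ρ ^ 2) + 4 * ρ ^ 2 * (u ^ 2 + v ^ 2)

/-- `v(x|t) = 1 - 2xt + t²`. -/
def vQH (x t : K) : K := 1 - 2 * x * t + t ^ 2

/-- Coefficient `e_n(a,b,c,d,q)` of the Askey–Wilson three-term recurrence. -/
def eAW (a b c d q : K) (n : ℕ) : K :=
  q ^ ((n : ℤ) - 2) /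
      ((1 - a * b * c * d * q ^ (2 * (n : ℤ) - 2)) * (1 - a * b * c * d * q ^ (2 * (n : ℤ)))) *
    ((a + b + c + d) * (q ^ 2 - a * b * c * d * q ^ (n : ℤ) * (1 + q - q ^ ((n : ℤ) + 1))) +
      (a * b * c + a * b * d + a * c * d + b * c * d) *
        (q - q ^ ((n : ℤ) + 2) - q ^ ((n : ℤ) + 1) + a * b * c * d * q ^ (2 * (n : ℤ))))

/-- Coefficient `f_n(a,b,c,d,q)` of the Askey–Wilson three-term recurrence. -/
def fAW (a b c d q : K) (n : ℕ) : K :=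
  (1 - q ^ (n : ℤ)) * (1 - a * b * q ^ ((n : ℤ) - 1)) * (1 - a * c * q ^ ((n : ℤ) - 1)) *
      (1 - a * d * q ^ ((n : ℤ) - 1)) * (1 - b * c * q ^ ((n : ℤ) - 1)) *
      (1 - b * d * q ^ ((n : ℤ) - 1)) * (1 - c * d * q ^ ((n : ℤ) - 1)) *
      (1 - a * b * c * d * q ^ ((n : ℤ) - 2)) /
    (qPoch (a * b * c * d * q ^ (2 * (n : ℤ) - 3)) q 3 *
      (1 - a * b * c * d * q ^ (2 * (n : ℤ) - 2)))

/-- Monic Askey–Wilson polynomials `α_n(x|a,b,c,d,q)`: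
`α_{-1} = 0`, `α_0 = 1`, `α_{n+1} = (2x - e_n) α_n - f_n α_{n-1}`. -/
def alphaAW (a b c d q x : K) : ℕ → K
  | 0 => 1
  | 1 => 2 * x - eAW a b c d q 0
  | n + 2 => (2 * x - eAW a b c d q (n + 1)) * alphaAW a b c d q x (n + 1) -
      fAW a b c d q (n + 1) * alphaAW a b c d q x n

/-- Coefficient of `ψ_n` in the continuous dual Hahn recurrence:
`q^n (b+c+d) + bcd q^{n-1} (1 - q^{n+1} - q^n)`. -/
def ePsi (b c d q : K) (n : ℕ) : K :=
  q ^ (n : ℤ) * (b + c + d) + b * c * d * q ^ ((n : ℤ) - 1) * (1 - q ^ ((n : ℤ) + 1) - q ^ (n : ℤ))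

/-- Coefficient of `ψ_{n-1}` in the continuous dual Hahn recurrence:
`(1-q^n)(1-bcq^{n-1})(1-bdq^{n-1})(1-cdq^{n-1})`. -/
def fPsi (b c d q : K) (n : ℕ) : K :=
  (1 - q ^ (n : ℤ)) * (1 - b * c * q ^ ((n : ℤ) - 1)) * (1 - b * d * q ^ ((n : ℤ) - 1)) *
    (1 - c * d * q ^ ((n : ℤ) - 1))

/-- Continuous dual Hahn polynomials `ψ_n(x|b,c,d,q)`:
`ψ_{-1} = 0`, `ψ_0 = 1`, `ψ_{n+1} = (2x - ePsi_n) ψ_n - fPsi_n ψ_{n-1}`. -/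
def psiCDH (b c d q x : K) : ℕ → K
  | 0 => 1
  | 1 => 2 * x - ePsi b c d q 0
  | n + 2 => (2 * x - ePsi b c d q (n + 1)) * psiCDH b c d q x (n + 1) -
      fPsi b c d q (n + 1) * psiCDH b c d q x n

/-- Al-Salam–Chihara polynomials `Q_n(x|c,d,q)`:
`Q_{-1} = 0`, `Q_0 = 1`, `Q_{n+1} = (2x - q^n(c+d)) Q_n - (1-q^n)(1-cdq^{n-1}) Q_{n-1}`. -/
def qASC (c d q x : K) : ℕ → K
  | 0 => 1
  | 1 => 2 * x - (c + d)
  | n + 2 => (2 * x - q ^ (n + 1) * (c + d)) * qASC c d q x (n + 1) -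
      (1 - q ^ (n + 1)) * (1 - c * d * q ^ n) * qASC c d q x n

/-- Coefficient `ẽ_n` of the conjugate-pair Askey–Wilson recurrence. -/
def eW (y ρ₁ z ρ₂ q : K) (n : ℕ) : K :=
  2 * q ^ ((n : ℤ) - 1) /
      ((1 - ρ₁ ^ 2 * ρ₂ ^ 2 * q ^ (2 * (n : ℤ) - 2)) *
        (1 - ρ₁ ^ 2 * ρ₂ ^ 2 * q ^ (2 * (n : ℤ)))) *
    (q * (ρ₁ * y + ρ₂ * z) *
        (1 - ρ₁ ^ 2 * ρ₂ ^ 2 * q ^ ((n : ℤ) - 2) * (1 + q - q ^ ((n : ℤ) + 1))) +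
      ρ₁ * ρ₂ * (ρ₁ * z + ρ₂ * y) *
        (1 - q ^ ((n : ℤ) + 1) - q ^ (n : ℤ) + ρ₁ ^ 2 * ρ₂ ^ 2 * q ^ (2 * (n : ℤ) - 1)))

/-- Coefficient `f̃_n` of the conjugate-pair Askey–Wilson recurrence. -/
def fW (y ρ₁ z ρ₂ q : K) (n : ℕ) : K :=
  (1 - q ^ (n : ℤ)) * omegaW y z (ρ₁ * ρ₂ * q ^ ((n : ℤ) - 1)) *
      (1 - ρ₁ ^ 2 * q ^ ((n : ℤ) - 1)) * (1 - ρ₂ ^ 2 * q ^ ((n : ℤ) - 1)) *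
      (1 - ρ₁ ^ 2 * ρ₂ ^ 2 * q ^ ((n : ℤ) - 2)) /
    (qPoch (ρ₁ ^ 2 * ρ₂ ^ 2 * q ^ (2 * (n : ℤ) - 3)) q 3 *
      (1 - ρ₁ ^ 2 * ρ₂ ^ 2 * q ^ (2 * (n : ℤ) - 2)))

/-- Conjugate-pair Askey–Wilson polynomials `w_n(x|y,ρ₁,z,ρ₂,q)`:
`w_{-1} = 0`, `w_0 = 1`, `w_{n+1} = (2x - ẽ_n) w_n - f̃_n w_{n-1}`. -/
def wAW (x y ρ₁ z ρ₂ q : K) : ℕ → K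
  | 0 => 1
  | 1 => 2 * x - eW y ρ₁ z ρ₂ q 0
  | n + 2 => (2 * x - eW y ρ₁ z ρ₂ q (n + 1)) * wAW x y ρ₁ z ρ₂ q (n + 1) -
      fW y ρ₁ z ρ₂ q (n + 1) * wAW x y ρ₁ z ρ₂ q n

/-- Chebyshev polynomials of the second kind. -/
def chebU (x : K) : ℕ → K
  | 0 => 1
  | 1 => 2 * x
  | n + 2 => 2 * x * chebU x (n + 1) - chebU x n

/-- The quantity `A_n` from the Askey–Wilson recurrence factorization. -/
def A_AW (a b c d q : K) (n : ℕ) : K :=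
  (1 - a * b * q ^ (n : ℤ)) * (1 - a * c * q ^ (n : ℤ)) * (1 - a * d * q ^ (n : ℤ)) *
      (1 - a * b * c * d * q ^ ((n : ℤ) - 1)) /
    (a * (1 - a * b * c * d * q ^ (2 * (n : ℤ) - 1)) * (1 - a * b * c * d * q ^ (2 * (n : ℤ))))

/-- The quantity `C_n` from the Askey–Wilson recurrence factorization. -/
def C_AW (a b c d q : K) (n : ℕ) : K :=
  a * (1 - q ^ (n : ℤ)) * (1 - b * c * q ^ ((n : ℤ) - 1)) * (1 - b * d * q ^ ((n : ℤ) - 1)) *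
      (1 - c * d * q ^ ((n : ℤ) - 1)) /
    ((1 - a * b * c * d * q ^ (2 * (n : ℤ) - 2)) * (1 - a * b * c * d * q ^ (2 * (n : ℤ) - 1)))

end Defs

section QBinomial

variable {K : Type*} [Field K]

@[simp] lemma qBinom_zero_right (q : K) (n : ℕ) : qBinom q n 0 = 1 := by
  cases n <;> rfl

lemma qBinom_succ_succ (q : K) (n k : ℕ) :
    qBinom q (n + 1) (k + 1) = qBinom q n k + q ^ (k + 1) * qBinom q n (k + 1) := rfl

lemma qBinom_eq_zero_of_lt (q : K) {n k : ℕ} (h : n < k) : qBinom q n k = 0 := by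
  induction n generalizing k with
  | zero =>
    obtain ⟨k, rfl⟩ := Nat.exists_eq_succ_of_ne_zero h.ne'
    rfl
  | succ n ih =>
    obtain ⟨k, rfl⟩ := Nat.exists_eq_succ_of_ne_zero (Nat.ne_zero_of_lt h)
    rw [Nat.succ_eq_add_one, qBinom_succ_succ, ih (by omega), ih (by omega)]
    ring

lemma one_sub_pow_mul_qBinom (q : K) (k r : ℕ) :
    (1 - q ^ r) * qBinom q (k + r) k = (1 - q ^ (k + 1)) * qBinom q (k + r) (k + 1) := by
  induction h : k + r generalizing k r with
  | zero =>
    obtain ⟨rfl, rfl⟩ : k = 0 ∧ r = 0 := by omega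
    simp [qBinom_eq_zero_of_lt]
  | succ n ih =>
    rcases r with _ | r
    · rw [qBinom_eq_zero_of_lt q (by omega : n + 1 < k + 1)]
      simp
    · have h₁ := ih k r (by omega)
      rcases k with _ | k
      · rw [qBinom_succ_succ]
        simp only [qBinom_zero_right] at h₁ ⊢
        linear_combination q * h₁
      · have h₂ := ih k (r + 1) (by omega)
        rw [qBinom_succ_succ q n (k + 1), qBinom_succ_succ q n k]
        linear_combination h₂ + q ^ (k + 2) * h₁

lemma qBinom_succ_succ' (q : K) {n k : ℕ} (h : k ≤ n) :
    qBinom q (n + 1) (k + 1) = q ^ (n - k) * qBinom q n k + qBinom q n (k + 1) := by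
  obtain ⟨r, rfl⟩ := Nat.exists_eq_add_of_le h
  rw [qBinom_succ_succ, Nat.add_sub_cancel_left]
  linear_combination one_sub_pow_mul_qBinom q k r

lemma one_sub_pow_succ_mul_qBinom (q : K) {n k : ℕ} (h : k ≤ n) :
    (1 - q ^ (n + 1)) * qBinom q n k = (1 - q ^ (n + 1 - k)) * qBinom q (n + 1) k := by
  obtain ⟨r, rfl⟩ := Nat.exists_eq_add_of_le h
  have h₁ := one_sub_pow_mul_qBinom q k (r + 1)
  have h₂ := one_sub_pow_mul_qBinom q k r
  rw [show k + r + 1 - k = r + 1 by omega]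
  rw [← add_assoc, qBinom_succ_succ] at h₁
  linear_combination -h₁ + q ^ (k + 1) * h₂

lemma qBinom_mul_qBinom (q : K) (m l i : ℕ) :
    qBinom q m (l + i) * qBinom q (l + i) l = qBinom q m l * qBinom q (m - l) i := by
  induction m generalizing l i with
  | zero =>
    rcases l with _ | l
    · simp
    · rw [qBinom_eq_zero_of_lt q (by omega : 0 < l + 1 + i),
        qBinom_eq_zero_of_lt q (by omega : 0 < l + 1)]
      simp
  | succ m ih =>
    rcases l with _ | l
    · simp
    · have h₁ := ih l i
      rw [show l + 1 + i = l + i + 1 by ring, Nat.add_sub_add_right]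
      rcases le_or_gt m l with hml | hml
      · have h₂ : qBinom q m (l + i + 1) = 0 := qBinom_eq_zero_of_lt q (by omega)
        have h₃ : qBinom q m (l + 1) = 0 := qBinom_eq_zero_of_lt q (by omega)
        rcases i with _ | i
        · simp only [add_zero, qBinom_zero_right] at h₁ h₂ ⊢
          have h₄ : qBinom q l (l + 1) = 0 := qBinom_eq_zero_of_lt q (by omega)
          rw [qBinom_succ_succ, qBinom_succ_succ, h₃, h₄]
          linear_combination h₁
        · have h₄ : qBinom q m (l + (i + 1)) = 0 := qBinom_eq_zero_of_lt q (by omega)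
          rw [h₄] at h₁
          rw [qBinom_succ_succ q m, qBinom_succ_succ q m, h₂, h₃, h₄]
          linear_combination h₁
      · have h₃ := ih (l + 1) i
        rw [show l + 1 + i = l + i + 1 by ring] at h₃
        rcases i with _ | i
        · simp only [add_zero, qBinom_zero_right] at h₁ h₃ ⊢
          have h₄ : qBinom q l (l + 1) = 0 := qBinom_eq_zero_of_lt q (by omega)
          rw [qBinom_succ_succ, qBinom_succ_succ, h₄]
          rw [qBinom_succ_succ, h₄] at h₃
          linear_combination h₁ + q ^ (l + 1) * h₃
        · have h₂ := ih (l + 1) i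
          obtain ⟨r, rfl⟩ := Nat.exists_eq_add_of_lt hml
          rw [show l + r + 1 - (l + 1) = r by omega] at h₂ h₃
          rw [show l + r + 1 - l = r + 1 by omega] at h₁ ⊢
          rw [show l + 1 + i = l + (i + 1) by ring] at h₂
          rw [qBinom_succ_succ q r i] at h₁ ⊢
          rw [qBinom_succ_succ q _ (l + (i + 1)), qBinom_succ_succ q _ l]
          rw [qBinom_succ_succ q _ l] at h₃ ⊢
          linear_combination h₁ + q ^ (l + 1) * h₂ + q ^ (l + i + 2) * h₃

lemma sum_qBinom_succ (q : K) (n : ℕ) (f : ℕ → K) :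
    ∑ k ∈ range (n + 2), qBinom q (n + 1) k * f k =
      ∑ k ∈ range (n + 1), qBinom q n k * (q ^ k * f k + f (k + 1)) := by
  have h : ∑ k ∈ range (n + 1), qBinom q n k * (q ^ k * f k) =
      ∑ k ∈ range (n + 1), q ^ (k + 1) * qBinom q n (k + 1) * f (k + 1) + f 0 := by
    have h' := sum_range_succ (fun k => qBinom q n k * (q ^ k * f k)) (n + 1)
    rw [qBinom_eq_zero_of_lt q (Nat.lt_succ_self n), zero_mul, add_zero] at h'
    rw [← h', sum_range_succ']
    simp only [qBinom_zero_right, pow_zero, one_mul]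
    exact congrArg (· + f 0) (sum_congr rfl fun k _ => by ring)
  rw [sum_range_succ']
  simp only [qBinom_succ_succ, add_mul, mul_add, sum_add_distrib, h, qBinom_zero_right]
  ring

lemma sum_qBinom_succ' (q : K) (n : ℕ) (f : ℕ → K) :
    ∑ k ∈ range (n + 2), qBinom q (n + 1) k * f k =
      ∑ k ∈ range (n + 1), qBinom q n k * (f k + q ^ (n - k) * f (k + 1)) := by
  have h : ∑ k ∈ range (n + 1), qBinom q n k * f k =
      ∑ k ∈ range (n + 1), qBinom q n (k + 1) * f (k + 1) + f 0 := by
    have h' := sum_range_succ (fun k => qBinom q n k * f k) (n + 1)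
    rw [qBinom_eq_zero_of_lt q (Nat.lt_succ_self n), zero_mul, add_zero] at h'
    rw [← h', sum_range_succ']
    simp only [qBinom_zero_right, one_mul]
  have h₂ : ∑ k ∈ range (n + 1), qBinom q (n + 1) (k + 1) * f (k + 1) =
      ∑ k ∈ range (n + 1), qBinom q n k * (q ^ (n - k) * f (k + 1)) +
        ∑ k ∈ range (n + 1), qBinom q n (k + 1) * f (k + 1) := by
    rw [← sum_add_distrib]
    refine sum_congr rfl fun k hk => ?_
    rw [qBinom_succ_succ' q (by simpa [Nat.lt_succ_iff] using hk)]
    ring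
  rw [sum_range_succ', h₂]
  simp only [mul_add, sum_add_distrib, h, qBinom_zero_right]
  ring

lemma one_sub_pow_mul_sum_qBinom (q : K) (n : ℕ) (f : ℕ → K) :
    (1 - q ^ (n + 1)) * ∑ k ∈ range (n + 1), qBinom q n k * f k =
      ∑ k ∈ range (n + 2), qBinom q (n + 1) k * ((1 - q ^ (n + 1 - k)) * f k) := by
  rw [sum_range_succ _ (n + 1), Nat.sub_self, mul_sum]
  simp only [pow_zero, sub_self, zero_mul, mul_zero, add_zero]
  refine sum_congr rfl fun k hk => ?_
  linear_combination f k *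
    one_sub_pow_succ_mul_qBinom q (by simpa [Nat.lt_succ_iff] using hk : k ≤ n)

/-- A three-term recurrence for the `q`-binomial transform of a sequence `T` with
`T (k + 1) / T k = (x - a q ^ k) (x - b q ^ k) / (1 - a b q ^ k)`. -/
lemma sum_qBinom_three_term (q a b x : K) (n : ℕ) (T : ℕ → K)
    (hT : ∀ k ≤ n + 1,
      (1 - a * b * q ^ k) * T (k + 1) = (x - a * q ^ k) * (x - b * q ^ k) * T k) :
    (1 - a * b * q ^ (n + 1)) * ∑ k ∈ range (n + 3), qBinom q (n + 2) k * T k =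
      (x ^ 2 + 1 - (a + b) * x * q ^ (n + 1)) * ∑ k ∈ range (n + 2), qBinom q (n + 1) k * T k -
        x ^ 2 * ((1 - q ^ (n + 1)) * ∑ k ∈ range (n + 1), qBinom q n k * T k) := by
  rw [sub_mul, one_mul]
  nth_rw 1 [sum_qBinom_succ' q (n + 1) T]
  rw [sum_qBinom_succ q (n + 1) T, one_sub_pow_mul_sum_qBinom q n T]
  simp only [mul_sum]
  rw [← sum_sub_distrib, ← sum_sub_distrib]
  refine sum_congr rfl fun k hk => ?_
  have hk' : k ≤ n + 1 := by simpa [Nat.lt_succ_iff] using hk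
  have hq : q ^ (n + 1) = q ^ (n + 1 - k) * q ^ k := by
    rw [← pow_add, Nat.sub_add_cancel hk']
  rw [hq]
  linear_combination qBinom q (n + 1) k * q ^ (n + 1 - k) * hT k hk'

/-- Solution of a `q`-difference recurrence by the finite `q`-binomial theorem. -/
lemma eq_sum_qBinom_of_q_difference (q b : K) (N : ℕ) (U : ℕ → ℕ → K)
    (hU : ∀ n j, n + j < N → U n (j + 1) = U n j - b * q ^ j * U (n + 1) j)
    (n j : ℕ) (h : n + j ≤ N) :
    U n j = ∑ l ∈ range (j + 1),
      qBinom q j l * ((-b) ^ l * q ^ (l * (l - 1) / 2) * U (n + l) 0) := by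
  induction j generalizing n with
  | zero => simp
  | succ j ih =>
    rw [hU n j (by omega), ih n (by omega), ih (n + 1) (by omega), sum_qBinom_succ', mul_sum,
      ← sum_sub_distrib]
    refine sum_congr rfl fun l hl => ?_
    have hl' : l ≤ j := by simpa [Nat.lt_succ_iff] using hl
    have hc : q ^ ((l + 1) * (l + 1 - 1) / 2) = q ^ l * q ^ (l * (l - 1) / 2) := by
      rw [← pow_add, ← Nat.choose_two_right, ← Nat.choose_two_right, Nat.choose_succ_succ,
        Nat.choose_one_right]
    have hq : q ^ j = q ^ (j - l) * q ^ l := by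
      rw [← pow_add, Nat.sub_add_cancel hl']
    rw [hc, hq, show n + 1 + l = n + (l + 1) by ring]
    ring

end QBinomial

section AlSalamChihara

variable {K : Type*} [Field K]

@[simp] lemma qPoch_zero (a q : K) : qPoch a q 0 = 1 := by simp [qPoch]

lemma qPoch_succ (a q : K) (n : ℕ) : qPoch a q (n + 1) = qPoch a q n * (1 - a * q ^ n) :=
  prod_range_succ _ _

lemma qPoch_ne_zero {a q : K} {n : ℕ} (h : ∀ j < n, 1 - a * q ^ j ≠ 0) : qPoch a q n ≠ 0 :=
  prod_ne_zero_iff.2 fun j hj => h j (mem_range.1 hj)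

lemma qPoch_zero_left (q : K) (n : ℕ) : qPoch 0 q n = 1 := by simp [qPoch]

/-- The inner sum of the conversion formula: for `j = 0` an Al-Salam–Chihara polynomial in
`(x + x⁻¹) / 2` with parameters `a`, `b`, divided by `(a b; q)_n`. -/
def shiftedSum (q a b x : K) (n j : ℕ) : K :=
  ∑ k ∈ range (n + 1), qBinom q n k *
    (qPoch (a / x) q k * (qPoch (b / x) q (k + j) / qPoch (a * b) q (k + j)) * (x ^ (2 * k) / x ^ n))

lemma qPoch_div_qPoch_succ {q a b : K} {k : ℕ} (h : ∀ j < k + 1, 1 - b * q ^ j ≠ 0) :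
    (1 - b * q ^ k) * (qPoch a q (k + 1) / qPoch b q (k + 1)) =
      (1 - a * q ^ k) * (qPoch a q k / qPoch b q k) := by
  have h₁ := h k (Nat.lt_succ_self k)
  have h₂ : qPoch b q k ≠ 0 := qPoch_ne_zero fun j hj => h j (by omega)
  rw [qPoch_succ, qPoch_succ]
  field_simp

lemma shiftedSum_succ_right {q a b x : K} (hx : x ≠ 0) {n j : ℕ}
    (h : ∀ i < n + j + 1, 1 - a * b * q ^ i ≠ 0) :
    (1 - b * x * q ^ j) * shiftedSum q a b x n (j + 1) =
      shiftedSum q a b x n j - b * q ^ j * shiftedSum q a b x (n + 1) j := by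
  unfold shiftedSum
  rw [sum_qBinom_succ]
  simp only [mul_sum]
  rw [← sum_sub_distrib]
  refine sum_congr rfl fun k hk => ?_
  have hk' : k ≤ n := by simpa [Nat.lt_succ_iff] using hk
  have hr := qPoch_div_qPoch_succ (q := q) (a := b / x) (b := a * b) (k := k + j)
    fun i hi => h i (by omega)
  rw [show k + (j + 1) = k + j + 1 by ring, show k + 1 + j = k + j + 1 by ring, qPoch_succ (a / x)]
  generalize qPoch (b / x) q (k + j + 1) / qPoch (a * b) q (k + j + 1) = d' at *
  generalize qPoch (b / x) q (k + j) / qPoch (a * b) q (k + j) = d at *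
  have e₁ : x ^ (2 * k) / x ^ (n + 1) = x ^ (2 * k) / x ^ n / x := by rw [pow_succ, div_div]
  have e₂ : x ^ (2 * (k + 1)) / x ^ (n + 1) = x ^ (2 * k) / x ^ n * x := by field_simp; ring
  rw [e₁, e₂]
  generalize x ^ (2 * k) / x ^ n = u
  rw [pow_add] at hr
  have hx' : x * x⁻¹ = 1 := mul_inv_cancel₀ hx
  simp only [div_eq_mul_inv] at *
  linear_combination qBinom q n k * qPoch (a * x⁻¹) q k * u * hr
    - qBinom q n k * qPoch (a * x⁻¹) q k * u * d' * a * b * q ^ k * q ^ j * hx'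

lemma pASC_div_qPoch_eq_shiftedSum {q x w t : K} [NeZero (2 : K)] (hx : x ≠ 0) (hw : w ≠ 0) {n : ℕ}
    (h : ∀ i < n, 1 - t ^ 2 * q ^ i ≠ 0) :
    pASC q ((x + x⁻¹) / 2) ((w + w⁻¹) / 2) t n / qPoch (t ^ 2) q n =
      shiftedSum q (t * w) (t / w) x n 0 := by
  have hab : t * w * (t / w) = t ^ 2 := by field_simp
  induction n using Nat.strong_induction_on with
  | _ n ih =>
  match n with
  | 0 => simp [pASC, shiftedSum]
  | 1 =>
    have h₀ := h 0 one_pos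
    simp only [pow_zero, mul_one] at h₀
    simp only [shiftedSum, hab, sum_range_succ, qPoch_succ, qBinom_succ_succ, pASC,
      qPoch_zero, qBinom_zero_right]
    simp [qBinom_eq_zero_of_lt q one_pos]
    field_simp
    ring
  | n + 2 =>
    have ih₁ := ih (n + 1) (by omega) fun i hi => h i (by omega)
    have ih₀ := ih n (by omega) fun i hi => h i (by omega)
    have hn₁ := h (n + 1) (by omega)
    have hn₀ := h n (by omega)
    have hP : qPoch (t ^ 2) q n ≠ 0 := qPoch_ne_zero fun i hi => h i (by omega)
    have hrec := sum_qBinom_three_term q (t * w) (t / w) x n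
      (fun k => qPoch (t * w / x) q k *
        (qPoch (t / w / x) q k / qPoch (t * w * (t / w)) q k) * x ^ (2 * k))
      (fun k hk => by
        have hr := qPoch_div_qPoch_succ (q := q) (a := t / w / x) (b := t * w * (t / w)) (k := k)
          fun i hi => by rw [hab]; exact h i (by omega)
        have e : x ^ (2 * (k + 1)) = x ^ (2 * k) * x ^ 2 := by ring
        have f₁ : x - t * w * q ^ k = x * (1 - t * w / x * q ^ k) := by field_simp
        have f₂ : x - t / w * q ^ k = x * (1 - t / w / x * q ^ k) := by field_simp
        simp only [qPoch_succ (t * w / x), e, f₁, f₂]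
        linear_combination qPoch (t * w / x) q k * (1 - t * w / x * q ^ k) * x ^ (2 * k) * x ^ 2 * hr)
    have key : ∀ r, shiftedSum q (t * w) (t / w) x r 0 =
        (∑ k ∈ range (r + 1), qBinom q r k * (qPoch (t * w / x) q k *
        (qPoch (t / w / x) q k / qPoch (t * w * (t / w)) q k) * x ^ (2 * k))) / x ^ r := by
      intro r
      rw [sum_div]
      exact sum_congr rfl fun k _ => by simp only [add_zero]; ring
    rw [key] at ih₀ ih₁ ⊢
    rw [eq_div_iff (pow_ne_zero _ hx)] at ih₀ ih₁ ⊢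
    rw [← ih₀, ← ih₁, hab] at hrec
    apply mul_left_cancel₀ hn₁
    simp only [hab] at hrec ⊢
    rw [hrec, pASC, qPoch_succ, qPoch_succ]
    field_simp
    ring

lemma hQH_eq_pASC_zero (q x y : K) (n : ℕ) : hQH q x n = pASC q x y 0 n := by
  induction n using Nat.strong_induction_on with
  | _ n ih =>
  match n with
  | 0 => rfl
  | 1 => simp [hQH, pASC]
  | n + 2 => simp [hQH, pASC, ih n (by omega), ih (n + 1) (by omega)]

lemma hQH_eq_sum {q w : K} [NeZero (2 : K)] (hw : w ≠ 0) (n : ℕ) :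
    hQH q ((w + w⁻¹) / 2) n = ∑ k ∈ range (n + 1), qBinom q n k * (w ^ (2 * k) / w ^ n) := by
  have h := pASC_div_qPoch_eq_shiftedSum (q := q) (t := 0) (n := n) hw one_ne_zero (by simp)
  rw [← hQH_eq_pASC_zero] at h
  simpa [shiftedSum, qPoch_zero_left] using h

lemma sum_qBinom_mul_qBinom_mul_pow {q w : K} [NeZero (2 : K)] (hw : w ≠ 0) {m l : ℕ} (hl : l ≤ m) :
    ∑ j ∈ range (m + 1), qBinom q m j * qBinom q j l * (w ^ (2 * j) / w ^ m / w ^ l) =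
      qBinom q m l * hQH q ((w + w⁻¹) / 2) (m - l) := by
  obtain ⟨r, rfl⟩ := Nat.exists_eq_add_of_le hl
  rw [hQH_eq_sum hw, mul_sum, add_assoc, sum_range_add, Nat.add_sub_cancel_left,
    sum_eq_zero fun j hj => by rw [qBinom_eq_zero_of_lt q (mem_range.1 hj)]; ring, zero_add]
  refine sum_congr rfl fun i _ => ?_
  rw [qBinom_mul_qBinom, Nat.add_sub_cancel_left, mul_assoc]
  congr 2
  field_simp
  ring

lemma conversion_formula_of_ne_zero {q x w t : K} [NeZero (2 : K)] (hx : x ≠ 0) (hw : w ≠ 0)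
    (n m : ℕ) (ht : ∀ j < n + m, 1 - t ^ 2 * q ^ j ≠ 0) :
    ∑ k ∈ range (n + 1), ∑ j ∈ range (m + 1), qBinom q n k * qBinom q m j *
        (qPoch (t * (w / x)) q k * qPoch (t * (x / w)) q j * qPoch (t * (x * w)⁻¹) q (k + j) /
          qPoch (t ^ 2) q (k + j)) * (x ^ (2 * k) / x ^ n) * (w ^ (2 * j) / w ^ m) =
      ∑ l ∈ range (m + 1), qBinom q m l * (-t) ^ l * q ^ (l * (l - 1) / 2) *
        hQH q ((w + w⁻¹) / 2) (m - l) *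
        (pASC q ((x + x⁻¹) / 2) ((w + w⁻¹) / 2) t (n + l) / qPoch (t ^ 2) q (n + l)) := by
  have hab : t * w * (t / w) = t ^ 2 := by field_simp
  set U : ℕ → ℕ → K := fun n j =>
    qPoch (t / w * x) q j * shiftedSum q (t * w) (t / w) x n j with hU
  have hdiff := eq_sum_qBinom_of_q_difference q (t / w) (n + m) U fun n' j hj => by
    have h := shiftedSum_succ_right (q := q) (a := t * w) (b := t / w) hx (n := n') (j := j)
      fun i hi => by rw [hab]; exact ht i (by omega)
    simp only [hU, qPoch_succ]
    linear_combination qPoch (t / w * x) q j * h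
  have hinner : ∀ j ∈ range (m + 1), U n j = ∑ l ∈ range (m + 1),
      qBinom q j l * ((-(t / w)) ^ l * q ^ (l * (l - 1) / 2) * U (n + l) 0) := by
    intro j hj
    have hj' := mem_range.1 hj
    rw [hdiff n j (by omega)]
    refine sum_subset (range_subset_range.2 (by omega)) fun l _ hl => ?_
    rw [qBinom_eq_zero_of_lt q (by simpa using hl), zero_mul]
  calc
    _ = ∑ j ∈ range (m + 1), qBinom q m j * (w ^ (2 * j) / w ^ m) * U n j := by
      rw [sum_comm]
      refine sum_congr rfl fun j _ => ?_
      simp only [hU, shiftedSum, mul_sum, hab]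
      refine sum_congr rfl fun k _ => ?_
      rw [show t * (w / x) = t * w / x by ring, show t * (x / w) = t / w * x by ring,
        show t * (x * w)⁻¹ = t / w / x by field_simp]
      ring
    _ = ∑ j ∈ range (m + 1), ∑ l ∈ range (m + 1), (-t) ^ l * q ^ (l * (l - 1) / 2) * U (n + l) 0 *
          (qBinom q m j * qBinom q j l * (w ^ (2 * j) / w ^ m / w ^ l)) := by
      refine sum_congr rfl fun j hj => ?_
      rw [hinner j hj, mul_sum]
      refine sum_congr rfl fun l _ => ?_
      rw [← neg_div, div_pow]
      ring
    _ = _ := by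
      rw [sum_comm]
      refine sum_congr rfl fun l hl => ?_
      have hl' := mem_range.1 hl
      rw [← mul_sum, sum_qBinom_mul_qBinom_mul_pow hw (by omega),
        pASC_div_qPoch_eq_shiftedSum hx hw fun i hi => ht i (by omega)]
      simp only [hU, qPoch_zero]
      ring

end AlSalamChihara

/-- Lemma (conversion formula): a double sum of complex exponentials equals a
combination of q-Hermite and Al-Salam–Chihara polynomials. -/
theorem conversion_formula (n m : ℕ) (θ η : ℝ) (q t : ℂ)
    (ht : ∀ j : ℕ, j < n + m → 1 - t ^ 2 * q ^ j ≠ 0) :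
    ∑ k ∈ Finset.range (n + 1), ∑ j ∈ Finset.range (m + 1),
        qBinom q n k * qBinom q m j *
          (qPoch (t * Complex.exp ((-(θ : ℂ) + (η : ℂ)) * Complex.I)) q k *
            qPoch (t * Complex.exp (((θ : ℂ) - (η : ℂ)) * Complex.I)) q j *
            qPoch (t * Complex.exp (-((θ : ℂ) + (η : ℂ)) * Complex.I)) q (k + j) /
            qPoch (t ^ 2) q (k + j)) *
          Complex.exp (((2 * (k : ℤ) - (n : ℤ) : ℤ) : ℂ) * (θ : ℂ) * Complex.I) *
          Complex.exp (((2 * (j : ℤ) - (m : ℤ) : ℤ) : ℂ) * (η : ℂ) * Complex.I) =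
      ∑ l ∈ Finset.range (m + 1),
        qBinom q m l * (-t) ^ l * q ^ (l * (l - 1) / 2) *
          hQH q ((Real.cos η : ℝ) : ℂ) (m - l) *
          (pASC q ((Real.cos θ : ℝ) : ℂ) ((Real.cos η : ℝ) : ℂ) t (n + l) /
            qPoch (t ^ 2) q (n + l)) := by
  have hcos : ∀ φ : ℝ, ((Real.cos φ : ℝ) : ℂ) =
      (Complex.exp (φ * Complex.I) + (Complex.exp (φ * Complex.I))⁻¹) / 2 := fun φ => by
    rw [Complex.ofReal_cos, Complex.cos, ← Complex.exp_neg, neg_mul]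
  have hpow : ∀ (φ : ℝ) (k r : ℕ), Complex.exp (((2 * (k : ℤ) - (r : ℤ) : ℤ) : ℂ) * φ * Complex.I) =
      Complex.exp (φ * Complex.I) ^ (2 * k) / Complex.exp (φ * Complex.I) ^ r := fun φ k r => by
    rw [← Complex.exp_nat_mul, ← Complex.exp_nat_mul, ← Complex.exp_sub]
    congr 1
    push_cast
    ring
  have h₁ : Complex.exp ((-(θ : ℂ) + η) * Complex.I) =
      Complex.exp (η * Complex.I) / Complex.exp (θ * Complex.I) := by
    rw [← Complex.exp_sub]
    ring_nf
  have h₂ : Complex.exp (((θ : ℂ) - η) * Complex.I) =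
      Complex.exp (θ * Complex.I) / Complex.exp (η * Complex.I) := by
    rw [← Complex.exp_sub]
    ring_nf
  have h₃ : Complex.exp (-((θ : ℂ) + η) * Complex.I) =
      (Complex.exp (θ * Complex.I) * Complex.exp (η * Complex.I))⁻¹ := by
    rw [← Complex.exp_add, ← Complex.exp_neg]
    ring_nf
  simp only [hcos, hpow, h₁, h₂, h₃]
  exact conversion_formula_of_ne_zero (Complex.exp_ne_zero _) (Complex.exp_ne_zero _) n m ht
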